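/- Let (Z,A) be generated from SBM(n,k,π,ρ_n S) with nρ_n → ∞ as n → ∞. Then for every δ > 0, P( max_{a,b ∈ [k]} | o_{ab}(Z)/n_{ab}(Z) − ρ_n S_{ab} | < √(δ ρ_n log n)/n ) → 1 as n → ∞. -/

import Mathlib

open Finset Filter
open scoped Classical BigOperators Topology

noncomputable section

namespace SBM

variable {n k : ℕ}

/-- Number of nodes with label `a`. -/
def nCount (z : Fin n → Fin k) (a : Fin k) : ℕ :=
  (Finset.univ.filter fun i => z i = a).card

/-- `n_{ab}(z)`. -/
def nab (z : Fin n → Fin k) (a b : Fin k) : ℝ :=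
  if a = b then (nCount z a : ℝ) * ((nCount z a : ℝ) - 1)
  else (nCount z a : ℝ) * (nCount z b : ℝ)

/-- `o_{ab}(z)`: number of (ordered) edges between communities `a` and `b`. -/
def oab (A : Fin n → Fin n → Bool) (z : Fin n → Fin k) (a b : Fin k) : ℝ :=
  ∑ i : Fin n, ∑ j : Fin n, if z i = a ∧ z j = b ∧ A i j = true then (1 : ℝ) else 0

/-- `τ(x) = x log x + (1-x) log(1-x)` (with `Real.log 0 = 0`, so `0 log 0 = 0`). -/
def tau (x : ℝ) : ℝ := x * Real.log x + (1 - x) * Real.log (1 - x)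

/-- Maximum likelihood modularity. -/
def QML (A : Fin n → Fin n → Bool) (z : Fin n → Fin k) : ℝ :=
  (1 / (2 * (n : ℝ) ^ 2)) *
    ∑ a : Fin k, ∑ b : Fin k, nab z a b * tau (oab A z a b / nab z a b)

/-- The Beta function. -/
def Beta (x y : ℝ) : ℝ := Real.Gamma x * Real.Gamma y / Real.Gamma (x + y)

def otilde (A : Fin n → Fin n → Bool) (z : Fin n → Fin k) (a b : Fin k) : ℝ :=
  if a = b then oab A z a b / 2 else oab A z a b

def ntilde (z : Fin n → Fin k) (a b : Fin k) : ℝ :=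
  if a = b then nab z a b / 2 else nab z a b

/-- Integrated conditional likelihood modularity. -/
def QICL (A : Fin n → Fin n → Bool) (z : Fin n → Fin k) : ℝ :=
  (1 / (n : ℝ) ^ 2) *
    ∑ p ∈ Finset.univ.filter (fun p : Fin k × Fin k => p.1 ≤ p.2),
      Real.log (Beta (otilde A z p.1 p.2 + 1 / 2)
          (ntilde z p.1 p.2 - otilde A z p.1 p.2 + 1 / 2) / Beta (1 / 2) (1 / 2))

/-- The adjacency matrix is symmetric with zero diagonal. -/
def ValidAdj (A : Fin n → Fin n → Bool) : Prop :=
  (∀ i j, A i j = A j i) ∧ ∀ i, A i i = false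

/-- Density of the conditional SBM edge model given the labels `z`:
independent Bernoulli(`ρ S (z i) (z j)`) edges for `i < j`. -/
def edgeDensity (ρ : ℝ) (S : Matrix (Fin k) (Fin k) ℝ) (z : Fin n → Fin k)
    (A : Fin n → Fin n → Bool) : ℝ :=
  ∏ p ∈ Finset.univ.filter (fun p : Fin n × Fin n => p.1 < p.2),
    (if A p.1 p.2 then ρ * S (z p.1) (z p.2) else 1 - ρ * S (z p.1) (z p.2))

/-- Conditional probability of an event on the adjacency matrix, given labels `z`. -/
def condProb (ρ : ℝ) (S : Matrix (Fin k) (Fin k) ℝ) (z : Fin n → Fin k)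
    (E : (Fin n → Fin n → Bool) → Prop) : ℝ :=
  ∑ A : Fin n → Fin n → Bool, if ValidAdj A ∧ E A then edgeDensity ρ S z A else 0

/-- Conditional expectation of a function of the adjacency matrix, given labels `z`. -/
def condExp (ρ : ℝ) (S : Matrix (Fin k) (Fin k) ℝ) (z : Fin n → Fin k)
    (f : (Fin n → Fin n → Bool) → ℝ) : ℝ :=
  ∑ A : Fin n → Fin n → Bool, if ValidAdj A then edgeDensity ρ S z A * f A else 0

/-- Probability of an event under the SBM: labels are i.i.d. `π`, edges are conditionally
independent Bernoulli(`ρ S (z i) (z j)`). -/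
def sbmProb (π : Fin k → ℝ) (ρ : ℝ) (S : Matrix (Fin k) (Fin k) ℝ)
    (E : (Fin n → Fin k) → (Fin n → Fin n → Bool) → Prop) : ℝ :=
  ∑ z : Fin n → Fin k, (∏ i, π (z i)) * condProb ρ S z (E z)

/-- Number of disagreements between two label vectors. -/
def hamming (e z : Fin n → Fin k) : ℕ :=
  (Finset.univ.filter fun i => e i ≠ z i).card

/-- Misclassification distance: minimum number of disagreements over permutations of labels. -/
def mDist (e z : Fin n → Fin k) : ℕ :=
  Finset.univ.inf' ⟨Equiv.refl (Fin k), Finset.mem_univ _⟩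
    (fun σ : Equiv.Perm (Fin k) => (Finset.univ.filter fun i => e i ≠ σ (z i)).card)

/-- Confusion matrix `R(e,z)`. -/
def confusion (e z : Fin n → Fin k) : Matrix (Fin k) (Fin k) ℝ :=
  Matrix.of fun a b => (1 / (n : ℝ)) * ∑ i : Fin n, if e i = a ∧ z i = b then (1 : ℝ) else 0

/-- `[R 1]_a` : row sums. -/
def rowSum (R : Matrix (Fin k) (Fin k) ℝ) (a : Fin k) : ℝ := ∑ j, R a j

/-- `[Rᵀ 1]_a` : column sums. -/
def colSum (R : Matrix (Fin k) (Fin k) ℝ) (a : Fin k) : ℝ := ∑ i, R i a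

/-- `[P_R]_{ab}`. -/
def PR (P R : Matrix (Fin k) (Fin k) ℝ) (n : ℕ) (a b : Fin k) : ℝ :=
  ((R * P * R.transpose) a b - (if a = b then (∑ i, P i i * R a i) / n else 0)) /
    (rowSum R a * (rowSum R b - if a = b then 1 / (n : ℝ) else 0))

/-- The population modularity `H_{P,n}(R)`. -/
def Hmod (P R : Matrix (Fin k) (Fin k) ℝ) (n : ℕ) : ℝ :=
  (1 / 2) * ∑ a : Fin k, ∑ b : Fin k,
    rowSum R a * (rowSum R b - if a = b then 1 / (n : ℝ) else 0) * tau (PR P R n a b)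

/-- The centered modularity `X(e,z)` (with `P = ρ S`). -/
def Xfun (ρ : ℝ) (S : Matrix (Fin k) (Fin k) ℝ) (A : Fin n → Fin n → Bool)
    (e z : Fin n → Fin k) : ℝ :=
  (1 / (2 * (n : ℝ) ^ 2)) * ∑ a : Fin k, ∑ b : Fin k,
    nab e a b * (tau (oab A e a b / nab e a b) - tau (PR (ρ • S) (confusion e z) n a b))

/-- The limit functional `G_S(R)` (terms with `[RSRᵀ]_{ab} = 0` vanish). -/
def GS (S R : Matrix (Fin k) (Fin k) ℝ) : ℝ :=
  ∑ a : Fin k, ∑ b : Fin k,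
    (R * S * R.transpose) a b *
      Real.log ((R * S * R.transpose) a b / (rowSum R a * rowSum R b))

/-- Entry-wise `ℓ¹` norm of a matrix. -/
def l1norm (M : Matrix (Fin k) (Fin k) ℝ) : ℝ := ∑ a : Fin k, ∑ b : Fin k, |M a b|

/-- `s_max`. -/
def sMax (S : Matrix (Fin k) (Fin k) ℝ) : ℝ :=
  sSup (Set.range fun p : Fin k × Fin k => S p.1 p.2)

/-- `s_min`. -/
def sMin (S : Matrix (Fin k) (Fin k) ℝ) : ℝ :=
  sInf (Set.range fun p : Fin k × Fin k => S p.1 p.2)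

/-- `H_t(p‖q) = (1-t)p + tq - p^{1-t} q^t`. -/
def Ht (t p q : ℝ) : ℝ := (1 - t) * p + t * q - p ^ (1 - t) * q ^ t

/-- `max_{t ∈ [0,1]} Σ_a π_a H_t(S_{ab} ‖ S_{ab'})`. -/
def CtMax (π : Fin k → ℝ) (S : Matrix (Fin k) (Fin k) ℝ) (b b' : Fin k) : ℝ :=
  sSup ((fun t => ∑ a : Fin k, π a * Ht t (S a b) (S a b')) '' Set.Icc (0 : ℝ) 1)

/-- The phase-transition constant `C(π,S)`. -/
def Cconst (π : Fin k → ℝ) (S : Matrix (Fin k) (Fin k) ℝ) : ℝ :=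
  sInf {x : ℝ | ∃ b b' : Fin k, b ≠ b' ∧ x = CtMax π S b b'}

/-- `K_t(p‖q) = p^{1-t} q^t + t p log(p/q) - p`. -/
def Kt (t p q : ℝ) : ℝ := p ^ (1 - t) * q ^ t + t * p * Real.log (p / q) - p

/-- `K₁(p‖q) = p log(p/q) + q - p`. -/
def K1 (p q : ℝ) : ℝ := p * Real.log (p / q) + q - p

/-- Kullback–Leibler divergence between Bernoulli(s) and Bernoulli(t). -/
def KLBern (s t : ℝ) : ℝ := s * Real.log (s / t) + (1 - s) * Real.log ((1 - s) / (1 - t))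

/-- Off-diagonal pairs of labels. -/
def offDiag (k : ℕ) : Finset (Fin k × Fin k) :=
  Finset.univ.filter fun p => p.1 ≠ p.2

/-- `C_t(R,S) = Σ_a Σ_{b ≠ b'} [Rᵀ1]_a K_t(S_{ab}‖S_{ab'}) R_{b'b}`. -/
def CtRS (t : ℝ) (R S : Matrix (Fin k) (Fin k) ℝ) : ℝ :=
  ∑ a : Fin k, ∑ p ∈ offDiag k, colSum R a * Kt t (S a p.1) (S a p.2) * R p.2 p.1

/-- Membership in `F(n,α)`: all communities have size at least `α n`. -/
def inF (α : ℝ) (z : Fin n → Fin k) : Prop := ∀ a, α * n ≤ (nCount z a : ℝ)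

/-- `zh` is a maximizer of the ML modularity over `F(n,α)`. -/
def IsMLE (α : ℝ) (A : Fin n → Fin n → Bool) (zh : Fin n → Fin k) : Prop :=
  inF α zh ∧ ∀ e : Fin n → Fin k, inF α e → QML A e ≤ QML A zh

/-- `zh` is a maximizer of the ICL modularity over `F(n,α)`. -/
def IsICL (α : ℝ) (A : Fin n → Fin n → Bool) (zh : Fin n → Fin k) : Prop :=
  inF α zh ∧ ∀ e : Fin n → Fin k, inF α e → QICL A e ≤ QICL A zh

/-- The weights of a product of finite probability vectors sum to one. -/
theorem sum_prod_weights {T α : Type*} [Fintype T] [DecidableEq T] [Fintype α] (w : T → α → ℝ)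
    (hw : ∀ t, ∑ a, w t a = 1) : ∑ x : T → α, ∏ t, w t (x t) = 1 := by
  rw [← Fintype.prod_sum]
  exact Finset.prod_eq_one fun t _ => hw t

/-- Second moment of a sum of independent centered variables on a finite product space. -/
theorem sum_prod_weights_mul_sq {T α : Type*} [Fintype T] [DecidableEq T] [Fintype α] (w g : T → α → ℝ)
    (hw : ∀ t, ∑ a, w t a = 1) (hg : ∀ t, ∑ a, w t a * g t a = 0) :
    ∑ x : T → α, (∏ t, w t (x t)) * (∑ t, g t (x t)) ^ 2 = ∑ t, ∑ a, w t a * g t a ^ 2 := by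
  have cov : ∀ s u : T, ∑ x : T → α, (∏ t, w t (x t)) * (g s (x s) * g u (x u)) =
      if s = u then ∑ a, w s a * g s a ^ 2 else 0 := by
    intro s u
    have h1 : ∀ x : T → α, (∏ t, w t (x t)) * (g s (x s) * g u (x u)) =
        ∏ t, w t (x t) * ((if t = s then g t (x t) else 1) * (if t = u then g t (x t) else 1)) := by
      intro x
      simp only [Finset.prod_mul_distrib, Finset.prod_ite_eq', Finset.mem_univ, if_true]
    simp_rw [h1]
    rw [← Fintype.prod_sum
      (fun t a => w t a * ((if t = s then g t a else 1) * (if t = u then g t a else 1)))]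
    split_ifs with h
    · subst h
      rw [Finset.prod_eq_single s]
      · simp [sq]
      · intro t _ ht
        simp [ht, hw]
      · simp
    · refine Finset.prod_eq_zero (Finset.mem_univ s) ?_
      simpa [h] using hg s
  simp_rw [sq (∑ t, g t _), Finset.sum_mul_sum, Finset.mul_sum]
  rw [Finset.sum_comm]
  refine Finset.sum_congr rfl fun s _ => ?_
  rw [Finset.sum_comm]
  simp_rw [cov]
  simp

/-- Chebyshev's inequality on a finite product space. -/
theorem sum_prod_weights_chebyshev {T α : Type*} [Fintype T] [DecidableEq T] [Fintype α] (w g : T → α → ℝ)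
    (hw0 : ∀ t a, 0 ≤ w t a) (hw : ∀ t, ∑ a, w t a = 1) (hg : ∀ t, ∑ a, w t a * g t a = 0)
    {s V : ℝ} (hs : 0 < s) (hV : ∑ t, ∑ a, w t a * g t a ^ 2 ≤ V)
    (E : (T → α) → Prop) (hE : ∀ x, E x → s ≤ |∑ t, g t (x t)|) :
    ∑ x : T → α, (if E x then ∏ t, w t (x t) else 0) ≤ V / s ^ 2 := by
  rw [le_div_iff₀ (by positivity)]
  refine le_trans ?_ hV
  rw [← sum_prod_weights_mul_sq w g hw hg, Finset.sum_mul]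
  refine Finset.sum_le_sum fun x _ => ?_
  have hp : 0 ≤ ∏ t, w t (x t) := Finset.prod_nonneg fun t _ => hw0 t _
  split_ifs with h
  · refine mul_le_mul_of_nonneg_left ?_ hp
    rw [← sq_abs (∑ t, g t (x t))]
    gcongr
    exact hE x h
  · rw [zero_mul]
    positivity

/-- Unordered pairs of nodes, represented with increasing coordinates. -/
abbrev Pairs (n : ℕ) := {p : Fin n × Fin n // p.1 < p.2}

/-- The adjacency matrix with prescribed entries above the diagonal. -/
def toAdj (x : Pairs n → Bool) (i j : Fin n) : Bool :=
  if h : i < j then x ⟨(i, j), h⟩ else if h : j < i then x ⟨(j, i), h⟩ else false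

theorem toAdj_valid (x : Pairs n → Bool) : ValidAdj (toAdj x) := by
  refine ⟨fun i j => ?_, fun i => by simp [toAdj]⟩
  rcases lt_trichotomy i j with h | h | h
  · simp [toAdj, h, h.le]
  · simp [h]
  · simp [toAdj, h, h.le]

theorem toAdj_apply (x : Pairs n → Bool) (p : Pairs n) : toAdj x p.1.1 p.1.2 = x p := by
  simp [toAdj, p.2]

/-- Bernoulli weight of an edge. -/
def edgeWeight (ρ : ℝ) (S : Matrix (Fin k) (Fin k) ℝ) (z : Fin n → Fin k) (p : Pairs n)
    (e : Bool) : ℝ :=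
  if e then ρ * S (z p.1.1) (z p.1.2) else 1 - ρ * S (z p.1.1) (z p.1.2)

theorem condProb_eq_sum (ρ : ℝ) (S : Matrix (Fin k) (Fin k) ℝ) (z : Fin n → Fin k)
    (E : (Fin n → Fin n → Bool) → Prop) :
    condProb ρ S z E =
      ∑ x : Pairs n → Bool, if E (toAdj x) then ∏ p, edgeWeight ρ S z p (x p) else 0 := by
  have h1 : condProb ρ S z E = ∑ A ∈ Finset.univ.filter (ValidAdj (n := n)),
      if E A then edgeDensity ρ S z A else 0 := by
    rw [condProb, Finset.sum_filter]
    refine Finset.sum_congr rfl fun A _ => ?_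
    by_cases hA : ValidAdj A <;> simp [hA]
  rw [h1]
  symm
  refine Finset.sum_bij' (fun x _ => toAdj x) (fun A _ p => A p.1.1 p.1.2) ?_ ?_ ?_ ?_ ?_
  · intro x _
    simpa using toAdj_valid x
  · simp
  · intro x _
    funext p
    exact toAdj_apply x p
  · intro A hA
    have hA' : ValidAdj A := by simpa using hA
    funext i j
    rcases lt_trichotomy i j with h | h | h
    · simp [toAdj, h]
    · simp [toAdj, h, hA'.2]
    · simp [toAdj, h, h.not_gt, hA'.1 i j]
  · intro x _
    congr 1
    rw [edgeDensity, Finset.prod_subtype (p := fun p : Fin n × Fin n => p.1 < p.2) _ (by simp)]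
    refine Finset.prod_congr rfl fun p _ => ?_
    rw [toAdj_apply]
    rfl

theorem sum_edgeWeight (ρ : ℝ) (S : Matrix (Fin k) (Fin k) ℝ) (z : Fin n → Fin k) (p : Pairs n) :
    ∑ e, edgeWeight ρ S z p e = 1 := by
  simp [edgeWeight]

theorem edgeWeight_nonneg {ρ : ℝ} {S : Matrix (Fin k) (Fin k) ℝ}
    (h : ∀ a b, 0 < ρ * S a b ∧ ρ * S a b < 1) (z : Fin n → Fin k) (p : Pairs n) (e : Bool) :
    0 ≤ edgeWeight ρ S z p e := by
  have := h (z p.1.1) (z p.1.2)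
  unfold edgeWeight
  split_ifs <;> linarith

theorem condProb_nonneg {ρ : ℝ} {S : Matrix (Fin k) (Fin k) ℝ}
    (h : ∀ a b, 0 < ρ * S a b ∧ ρ * S a b < 1) (z : Fin n → Fin k)
    (E : (Fin n → Fin n → Bool) → Prop) : 0 ≤ condProb ρ S z E := by
  rw [condProb_eq_sum]
  refine Finset.sum_nonneg fun x _ => ?_
  split_ifs
  · exact Finset.prod_nonneg fun p _ => edgeWeight_nonneg h z p _
  · exact le_rfl

theorem condProb_add_condProb_not (ρ : ℝ) (S : Matrix (Fin k) (Fin k) ℝ) (z : Fin n → Fin k)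
    (E : (Fin n → Fin n → Bool) → Prop) :
    condProb ρ S z E + condProb ρ S z (fun A => ¬ E A) = 1 := by
  rw [condProb_eq_sum, condProb_eq_sum, ← Finset.sum_add_distrib,
    ← sum_prod_weights (edgeWeight ρ S z) (sum_edgeWeight ρ S z)]
  refine Finset.sum_congr rfl fun x _ => ?_
  by_cases hx : E (toAdj x) <;> simp [hx]

/-- Union bound. -/
theorem sum_exists_le {ι β : Type*} [Fintype ι] [Fintype β] (W : β → ℝ) (hW : ∀ x, 0 ≤ W x)
    (E : ι → β → Prop) [∀ i x, Decidable (E i x)] [∀ x, Decidable (∃ i, E i x)] :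
    ∑ x, (if ∃ i, E i x then W x else 0) ≤ ∑ i, ∑ x, if E i x then W x else 0 := by
  rw [Finset.sum_comm]
  refine Finset.sum_le_sum fun x _ => ?_
  have h0 : ∀ i ∈ Finset.univ, 0 ≤ if E i x then W x else 0 := fun i _ => by
    split_ifs
    exacts [hW x, le_rfl]
  split_ifs with h
  · obtain ⟨i, hi⟩ := h
    simpa [hi] using Finset.single_le_sum h0 (Finset.mem_univ i)
  · exact Finset.sum_nonneg h0

theorem condProb_exists_le {ι : Type*} [Fintype ι] {ρ : ℝ} {S : Matrix (Fin k) (Fin k) ℝ}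
    (h : ∀ a b, 0 < ρ * S a b ∧ ρ * S a b < 1) (z : Fin n → Fin k)
    (E : ι → (Fin n → Fin n → Bool) → Prop) :
    condProb ρ S z (fun A => ∃ i, E i A) ≤ ∑ i, condProb ρ S z (E i) := by
  simp_rw [condProb_eq_sum]
  convert sum_exists_le (fun x : Pairs n → Bool => ∏ p, edgeWeight ρ S z p (x p))
    (fun x => Finset.prod_nonneg fun p _ => edgeWeight_nonneg h z p _)
    (fun i x => E i (toAdj x))

/-- A double sum vanishing on the diagonal, folded onto increasing pairs. -/
theorem sum_sum_eq_sum_pairs (F : Fin n → Fin n → ℝ) (hF : ∀ i, F i i = 0) :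
    ∑ i, ∑ j, F i j = ∑ p : Pairs n, (F p.1.1 p.1.2 + F p.1.2 p.1.1) := by
  rw [← Finset.sum_subtype (p := fun p : Fin n × Fin n => p.1 < p.2)
    (Finset.univ.filter fun p : Fin n × Fin n => p.1 < p.2) (by simp)
    (fun p => F p.1 p.2 + F p.2 p.1), Finset.sum_filter, Fintype.sum_prod_type]
  have hswap : ∑ i, ∑ j, (if i < j then F j i else 0) = ∑ i, ∑ j, if j < i then F i j else 0 :=
    Finset.sum_comm
  have hsplit : ∀ i j, (if i < j then F i j + F j i else 0) =
      (if i < j then F i j else 0) + if i < j then F j i else 0 := by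
    intro i j
    split_ifs <;> simp
  simp_rw [hsplit, Finset.sum_add_distrib]
  rw [hswap, ← Finset.sum_add_distrib]
  refine Finset.sum_congr rfl fun i _ => ?_
  rw [← Finset.sum_add_distrib]
  refine Finset.sum_congr rfl fun j _ => ?_
  rcases lt_trichotomy i j with h | h | h
  · simp [h, h.not_gt]
  · simp [h, hF]
  · simp [h, h.not_gt]

theorem nCount_eq_sum (z : Fin n → Fin k) (a : Fin k) :
    (nCount z a : ℝ) = ∑ i, if z i = a then (1 : ℝ) else 0 := by
  simp [nCount]

theorem nab_eq_sum (z : Fin n → Fin k) (a b : Fin k) :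
    nab z a b = ∑ i, ∑ j, if z i = a ∧ z j = b ∧ i ≠ j then (1 : ℝ) else 0 := by
  have h1 : ∀ i j, (if z i = a ∧ z j = b ∧ i ≠ j then (1 : ℝ) else 0) =
      (if z i = a then 1 else 0) * (if z j = b then 1 else 0) -
        if i = j then (if z i = a ∧ z i = b then 1 else 0) else 0 := by
    intro i j
    by_cases hij : i = j
    · subst hij
      by_cases ha : z i = a <;> by_cases hb : z i = b <;> simp [ha, hb]
    · by_cases ha : z i = a <;> by_cases hb : z j = b <;> simp [ha, hb, hij]
  simp_rw [h1, Finset.sum_sub_distrib, ← Finset.mul_sum, ← Finset.sum_mul, ← nCount_eq_sum]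
  simp only [Finset.sum_ite_eq, Finset.mem_univ, if_true]
  unfold nab
  split_ifs with h
  · subst h
    simp only [and_self, ← nCount_eq_sum]
    ring
  · rw [Finset.sum_eq_zero (f := fun i => if z i = a ∧ z i = b then (1 : ℝ) else 0)]
    · ring
    · intro i _
      rw [if_neg]
      rintro ⟨rfl, h2⟩
      exact h h2

/-- Multiplicity of an unordered pair in the block `(a, b)`. -/
def pairCoeff (z : Fin n → Fin k) (a b : Fin k) (p : Pairs n) : ℝ :=
  (if z p.1.1 = a ∧ z p.1.2 = b then 1 else 0) + if z p.1.2 = a ∧ z p.1.1 = b then 1 else 0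

/-- Centered contribution of an unordered pair to the block `(a, b)`. -/
def edgeDev (ρ : ℝ) (S : Matrix (Fin k) (Fin k) ℝ) (z : Fin n → Fin k) (a b : Fin k)
    (p : Pairs n) (e : Bool) : ℝ :=
  pairCoeff z a b p * ((if e then 1 else 0) - ρ * S (z p.1.1) (z p.1.2))

theorem oab_sub_eq_sum (ρ : ℝ) {S : Matrix (Fin k) (Fin k) ℝ} (hS : S.IsSymm) (z : Fin n → Fin k)
    (a b : Fin k) (x : Pairs n → Bool) :
    oab (toAdj x) z a b - nab z a b * (ρ * S a b) = ∑ p, edgeDev ρ S z a b p (x p) := by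
  rw [nab_eq_sum, oab, sum_sum_eq_sum_pairs, sum_sum_eq_sum_pairs, Finset.sum_mul,
    ← Finset.sum_sub_distrib]
  · refine Finset.sum_congr rfl fun p _ => ?_
    have h1 := toAdj_apply x p
    have h2 : toAdj x p.1.2 p.1.1 = x p := ((toAdj_valid x).1 _ _).trans h1
    have h3 : p.1.1 ≠ p.1.2 := p.2.ne
    rw [h1, h2]
    have h4 : pairCoeff z a b p * S (z p.1.1) (z p.1.2) = pairCoeff z a b p * S a b := by
      by_cases c1 : z p.1.1 = a ∧ z p.1.2 = b
      · rw [c1.1, c1.2]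
      · by_cases c2 : z p.1.2 = a ∧ z p.1.1 = b
        · rw [c2.1, c2.2, hS.apply a b]
        · simp [pairCoeff, c1, c2]
    rw [edgeDev, mul_sub, mul_left_comm (pairCoeff z a b p), h4, pairCoeff]
    simp only [ne_eq, h3, h3.symm, not_false_eq_true, and_true]
    cases x p <;> simp <;> ring
  · simp
  · intro i
    simp [(toAdj_valid x).2 i]

theorem pairCoeff_sq_le (z : Fin n → Fin k) (a b : Fin k) (p : Pairs n) :
    pairCoeff z a b p ^ 2 ≤ 4 := by
  unfold pairCoeff
  split_ifs <;> norm_num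

theorem card_pairs_le (n : ℕ) : (Fintype.card (Pairs n) : ℝ) ≤ (n : ℝ) ^ 2 := by
  have h := Fintype.card_subtype_le fun p : Fin n × Fin n => p.1 < p.2
  rw [Fintype.card_prod, Fintype.card_fin] at h
  rw [sq]
  exact_mod_cast h

theorem sum_edgeWeight_mul_edgeDev (ρ : ℝ) (S : Matrix (Fin k) (Fin k) ℝ) (z : Fin n → Fin k)
    (a b : Fin k) (p : Pairs n) : ∑ e, edgeWeight ρ S z p e * edgeDev ρ S z a b p e = 0 := by
  simp [edgeWeight, edgeDev]
  ring

theorem sum_edgeWeight_mul_edgeDev_sq_le {ρ : ℝ} (hρ : 0 ≤ ρ) {S : Matrix (Fin k) (Fin k) ℝ}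
    (h : ∀ a b, 0 < ρ * S a b ∧ ρ * S a b < 1) {M : ℝ} (hM : ∀ a b, S a b ≤ M)
    (z : Fin n → Fin k) (a b : Fin k) :
    ∑ p, ∑ e, edgeWeight ρ S z p e * edgeDev ρ S z a b p e ^ 2 ≤ (n : ℝ) ^ 2 * (4 * (ρ * M)) := by
  have hterm : ∀ p, ∑ e, edgeWeight ρ S z p e * edgeDev ρ S z a b p e ^ 2 ≤ 4 * (ρ * M) := by
    intro p
    have h1 : ∑ e, edgeWeight ρ S z p e * edgeDev ρ S z a b p e ^ 2 =
        pairCoeff z a b p ^ 2 *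
          (ρ * S (z p.1.1) (z p.1.2) * (1 - ρ * S (z p.1.1) (z p.1.2))) := by
      simp [edgeWeight, edgeDev]
      ring
    have h2 := h (z p.1.1) (z p.1.2)
    have h3 := mul_le_mul_of_nonneg_left (hM (z p.1.1) (z p.1.2)) hρ
    rw [h1]
    refine mul_le_mul (pairCoeff_sq_le z a b p) ?_ ?_ (by norm_num)
    · nlinarith
    · exact mul_nonneg h2.1.le (by linarith)
  rcases isEmpty_or_nonempty (Pairs n) with hn | ⟨⟨p⟩⟩
  · rcases Nat.eq_zero_or_pos n with rfl | hn'
    · simp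
    · have hM0 : 0 ≤ ρ * M := by
        have h1 := h a b
        have h2 := mul_le_mul_of_nonneg_left (hM a b) hρ
        linarith
      rw [Finset.univ_eq_empty, Finset.sum_empty]
      positivity
  · have hM0 : 0 ≤ ρ * M := by
      have h1 := h a b
      have h2 := mul_le_mul_of_nonneg_left (hM a b) hρ
      linarith
    calc _ ≤ ∑ _p : Pairs n, 4 * (ρ * M) := Finset.sum_le_sum fun p _ => hterm p
      _ = (Fintype.card (Pairs n) : ℝ) * (4 * (ρ * M)) := by simp
      _ ≤ _ := mul_le_mul_of_nonneg_right (card_pairs_le n) (by positivity)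

/-- Conditional deviation bound for one block, given that the block is large. -/
theorem condProb_block_dev_le {ρ : ℝ} (hρ : 0 < ρ) {S : Matrix (Fin k) (Fin k) ℝ}
    (hS : S.IsSymm) (h : ∀ a b, 0 < ρ * S a b ∧ ρ * S a b < 1) {M : ℝ} (hM : ∀ a b, S a b ≤ M)
    (z : Fin n → Fin k) (a b : Fin k) {c L : ℝ} (hc : 0 < c) (hL : 0 < L) (hn : 0 < n)
    (hnab : c * (n : ℝ) ^ 2 ≤ nab z a b) :
    condProb ρ S z (fun A => Real.sqrt (ρ * L) / n ≤ |oab A z a b / nab z a b - ρ * S a b|) ≤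
      4 * M / (c ^ 2 * L) := by
  have hn' : (0 : ℝ) < n := by exact_mod_cast hn
  have hpos : 0 < nab z a b := lt_of_lt_of_le (by positivity) hnab
  have hs : 0 < c * n * Real.sqrt (ρ * L) := by positivity
  rw [condProb_eq_sum]
  refine (sum_prod_weights_chebyshev (edgeWeight ρ S z) (edgeDev ρ S z a b)
    (edgeWeight_nonneg h z) (sum_edgeWeight ρ S z) (sum_edgeWeight_mul_edgeDev ρ S z a b) hs
    (sum_edgeWeight_mul_edgeDev_sq_le hρ.le h hM z a b) _ ?_).trans_eq ?_
  · intro x hx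
    rw [← oab_sub_eq_sum ρ hS z a b x]
    have h1 : oab (toAdj x) z a b - nab z a b * (ρ * S a b) =
        nab z a b * (oab (toAdj x) z a b / nab z a b - ρ * S a b) := by
      field_simp
    rw [h1, abs_mul, abs_of_pos hpos]
    calc c * n * Real.sqrt (ρ * L) = c * (n : ℝ) ^ 2 * (Real.sqrt (ρ * L) / n) := by field_simp
      _ ≤ _ := mul_le_mul hnab hx (by positivity) hpos.le
  · rw [mul_pow, Real.sq_sqrt (by positivity)]
    field_simp

/-- The size of a block is bounded below when its communities are. -/
theorem le_nab (z : Fin n → Fin k) {π : Fin k → ℝ}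
    (hz : ∀ a, π a * n / 2 ≤ nCount z a) (hn : ∀ a, 4 ≤ π a * n) (a b : Fin k) :
    π a * π b / 8 * (n : ℝ) ^ 2 ≤ nab z a b := by
  have ha := hz a
  have hb := hz b
  have hna := hn a
  have hnb := hn b
  unfold nab
  split_ifs with hab
  · subst hab
    nlinarith
  · nlinarith [mul_le_mul ha hb (by linarith) (by linarith)]

/-- Chebyshev bound for the size of one community. -/
theorem sum_weights_small_community_le {π : Fin k → ℝ} (hπ : ∀ a, 0 < π a)
    (hπsum : ∑ a, π a = 1) (a : Fin k) (hn : 0 < n) :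
    ∑ z : Fin n → Fin k, (if (nCount z a : ℝ) < π a * n / 2 then ∏ i, π (z i) else 0) ≤
      4 / π a ^ 2 / n := by
  have hn' : (0 : ℝ) < n := by exact_mod_cast hn
  have hpa := hπ a
  have hle : π a ≤ 1 := hπsum ▸ Finset.single_le_sum (fun b _ => (hπ b).le) (Finset.mem_univ a)
  refine (sum_prod_weights_chebyshev (fun (_ : Fin n) b => π b)
    (fun _ b => (if b = a then 1 else 0) - π a) (fun _ b => (hπ b).le) (fun _ => hπsum) ?_
    (s := π a * n / 2) (V := n) (by positivity) ?_ _ ?_).trans_eq ?_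
  · intro _
    simp [mul_sub, Finset.sum_sub_distrib, ← Finset.sum_mul, hπsum]
  · have h1 : ∀ b, ((if b = a then (1 : ℝ) else 0) - π a) ^ 2 ≤ 1 := by
      intro b
      split_ifs <;> nlinarith
    calc _ ≤ ∑ _i : Fin n, ∑ b, π b := by
          gcongr with i _ b _
          exact mul_le_of_le_one_right (hπ b).le (h1 b)
      _ = n := by simp [hπsum]
  · intro z hz
    have h1 : ∑ i, ((if z i = a then (1 : ℝ) else 0) - π a) = nCount z a - n * π a := by
      rw [Finset.sum_sub_distrib, ← nCount_eq_sum]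
      simp
    rw [h1, abs_sub_comm]
    refine le_trans ?_ (le_abs_self _)
    linarith
  · field_simp
    norm_num

/-- Finite-sample bound for the failure probability of the concentration event. -/
theorem one_sub_le_sbmProb {π : Fin k → ℝ} (hπ : ∀ a, 0 < π a) (hπsum : ∑ a, π a = 1)
    {ρ : ℝ} (hρ : 0 < ρ) {S : Matrix (Fin k) (Fin k) ℝ} (hS : S.IsSymm)
    (h : ∀ a b, 0 < ρ * S a b ∧ ρ * S a b < 1) {M : ℝ} (hM : ∀ a b, S a b ≤ M)
    {L : ℝ} (hL : 0 < L) (hn : 0 < n) (hn4 : ∀ a, 4 ≤ π a * n) :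
    sbmProb π ρ S (fun (z : Fin n → Fin k) A => ∀ a b : Fin k,
        |oab A z a b / nab z a b - ρ * S a b| < Real.sqrt (ρ * L) / n) ≤ 1 ∧
      1 - (∑ a, 4 / π a ^ 2 / n +
        ∑ p : Fin k × Fin k, 4 * M / ((π p.1 * π p.2 / 8) ^ 2 * L)) ≤
      sbmProb π ρ S (fun (z : Fin n → Fin k) A => ∀ a b : Fin k,
        |oab A z a b / nab z a b - ρ * S a b| < Real.sqrt (ρ * L) / n) := by
  set E : (Fin n → Fin k) → (Fin n → Fin n → Bool) → Prop := fun z A => ∀ a b : Fin k,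
    |oab A z a b / nab z a b - ρ * S a b| < Real.sqrt (ρ * L) / n with hE
  have hW : ∀ z : Fin n → Fin k, 0 ≤ ∏ i, π (z i) :=
    fun z => Finset.prod_nonneg fun i _ => (hπ _).le
  have hWsum : ∑ z : Fin n → Fin k, ∏ i, π (z i) = 1 :=
    sum_prod_weights (fun (_ : Fin n) b => π b) fun _ => hπsum
  have hM0 : 0 ≤ M := by
    have hk : Nonempty (Fin k) := by
      by_contra hk
      rw [not_nonempty_iff] at hk
      simp at hπsum
    obtain ⟨a⟩ := hk
    exact (pos_of_mul_pos_right (h a a).1 hρ.le).le.trans (hM a a)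
  have hsum : sbmProb π ρ S E + sbmProb π ρ S (fun z A => ¬ E z A) = 1 := by
    rw [sbmProb, sbmProb, ← Finset.sum_add_distrib, ← hWsum]
    refine Finset.sum_congr rfl fun z _ => ?_
    rw [← mul_add, condProb_add_condProb_not, mul_one]
  have hnn : 0 ≤ sbmProb π ρ S (fun z A => ¬ E z A) :=
    Finset.sum_nonneg fun z _ => mul_nonneg (hW z) (condProb_nonneg h z _)
  refine ⟨by linarith, ?_⟩
  set ε := ∑ p : Fin k × Fin k, 4 * M / ((π p.1 * π p.2 / 8) ^ 2 * L) with hε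
  have hε0 : 0 ≤ ε := Finset.sum_nonneg fun p _ => by positivity
  have hgood : ∀ z : Fin n → Fin k, (∀ a, π a * n / 2 ≤ nCount z a) →
      condProb ρ S z (fun A => ¬ E z A) ≤ ε := by
    intro z hz
    have hiff : ∀ A, ¬ E z A ↔ ∃ p : Fin k × Fin k, Real.sqrt (ρ * L) / n ≤
        |oab A z p.1 p.2 / nab z p.1 p.2 - ρ * S p.1 p.2| := by
      intro A
      simp [hE]
    simp_rw [hiff]
    refine (condProb_exists_le h z _).trans (Finset.sum_le_sum fun p _ => ?_)
    have hp1 := hπ p.1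
    have hp2 := hπ p.2
    exact condProb_block_dev_le hρ hS h hM z p.1 p.2 (c := π p.1 * π p.2 / 8)
      (by positivity) hL hn (le_nab z hz hn4 p.1 p.2)
  have hbad : sbmProb π ρ S (fun z A => ¬ E z A) ≤
      (∑ z : Fin n → Fin k,
        if ∃ a, (nCount z a : ℝ) < π a * n / 2 then ∏ i, π (z i) else 0) + ε := by
    have hεsum : ε = ∑ z : Fin n → Fin k, (∏ i, π (z i)) * ε := by
      rw [← Finset.sum_mul, hWsum, one_mul]
    rw [hεsum, ← Finset.sum_add_distrib]
    refine Finset.sum_le_sum fun z _ => ?_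
    have hle1 : condProb ρ S z (fun A => ¬ E z A) ≤ 1 := by
      have h1 := condProb_add_condProb_not ρ S z (E z)
      have h2 := condProb_nonneg h z (E z)
      linarith
    split_ifs with hz
    · nlinarith [mul_le_mul_of_nonneg_left hle1 (hW z), mul_nonneg (hW z) hε0]
    · push Not at hz
      rw [zero_add]
      exact mul_le_mul_of_nonneg_left (hgood z hz) (hW z)
  have hlabels := (sum_exists_le (fun z : Fin n → Fin k => ∏ i, π (z i)) hW
    (fun a z => (nCount z a : ℝ) < π a * n / 2)).trans
    (Finset.sum_le_sum fun a _ => sum_weights_small_community_le hπ hπsum a hn)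
  linarith

/-- concentration of the empirical edge probabilities at the true labels. -/
theorem stmt11 (k : ℕ) (π : Fin k → ℝ) (hπpos : ∀ a, 0 < π a) (hπsum : ∑ a, π a = 1)
    (S : Matrix (Fin k) (Fin k) ℝ) (hSsym : S.IsSymm) (hSpos : ∀ a b, 0 < S a b)
    (ρ : ℕ → ℝ)
    (hρrange : ∀ᶠ n in (atTop : Filter ℕ), 0 < ρ n ∧ ∀ a b, ρ n * S a b < 1)
    (hnρ : Tendsto (fun n : ℕ => (n : ℝ) * ρ n) atTop atTop)
    (δ : ℝ) (hδ : 0 < δ) :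
    Tendsto (fun n : ℕ => sbmProb π (ρ n) S
        (fun (z : Fin n → Fin k) (A : Fin n → Fin n → Bool) =>
          ∀ a b : Fin k,
            |oab A z a b / nab z a b - ρ n * S a b| <
              Real.sqrt (δ * ρ n * Real.log n) / n))
      atTop (nhds 1) := by
  have hM : ∀ a b, S a b ≤ ∑ a, ∑ b, S a b := fun a b =>
    (Finset.single_le_sum (fun b _ => (hSpos a b).le) (Finset.mem_univ b)).trans
      (Finset.single_le_sum (f := fun a => ∑ b, S a b)
        (fun a _ => Finset.sum_nonneg fun b _ => (hSpos a b).le) (Finset.mem_univ a))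
  have hcast := tendsto_natCast_atTop_atTop (R := ℝ)
  have hlog : Tendsto (fun n : ℕ => δ * Real.log n) atTop atTop :=
    (Real.tendsto_log_atTop.comp hcast).const_mul_atTop hδ
  have hn4 : ∀ᶠ n : ℕ in atTop, ∀ a, 4 ≤ π a * n :=
    eventually_all.2 fun a => (hcast.const_mul_atTop (hπpos a)).eventually_ge_atTop 4
  have hbound := (((hρrange.and hn4).and (eventually_gt_atTop 0)).and
    (hlog.eventually_gt_atTop 0)).mono fun n hn =>
      one_sub_le_sbmProb hπpos hπsum hn.1.1.1.1 hSsym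
        (fun a b => ⟨mul_pos hn.1.1.1.1 (hSpos a b), hn.1.1.1.2 a b⟩) hM hn.2 hn.1.2 hn.1.1.2
  have hfail : Tendsto (fun n : ℕ => 1 - (∑ a, 4 / π a ^ 2 / (n : ℝ) +
      ∑ p : Fin k × Fin k, 4 * (∑ a, ∑ b, S a b) /
        ((π p.1 * π p.2 / 8) ^ 2 * (δ * Real.log n)))) atTop (nhds 1) := by
    have h1 : Tendsto (fun n : ℕ => ∑ a, 4 / π a ^ 2 / (n : ℝ)) atTop (nhds (∑ _a : Fin k, 0)) :=
      tendsto_finsetSum _ fun a _ => tendsto_const_nhds.div_atTop hcast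
    have h2 : Tendsto (fun n : ℕ => ∑ p : Fin k × Fin k, 4 * (∑ a, ∑ b, S a b) /
        ((π p.1 * π p.2 / 8) ^ 2 * (δ * Real.log n))) atTop
        (nhds (∑ _p : Fin k × Fin k, 0)) :=
      tendsto_finsetSum _ fun p _ => tendsto_const_nhds.div_atTop (hlog.const_mul_atTop (by
        have := hπpos p.1
        have := hπpos p.2
        positivity))
    simpa using (h1.add h2).const_sub 1
  have hrw : ∀ n : ℕ, δ * ρ n * Real.log n = ρ n * (δ * Real.log n) := fun n => by ring
  simp_rw [hrw]
  exact tendsto_of_tendsto_of_tendsto_of_le_of_le' hfail tendsto_const_nhds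
    (hbound.mono fun n hn => hn.2) (hbound.mono fun n hn => hn.1)
end SBM
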